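/- arXiv:2507.02896 — 4 statements merged into one kernel-verified Lean document; each statement's English description precedes it below -/
import Mathlib

section
/- (Region A) Let D be the midpoint of segment AB and θ = ∠ B A C. The circular segment of the circle with center D and radius c/2 cut off by the chord AC, on the side of line AC opposite to B — that is, the set of points x with dist x D ≤ c/2 lying on the opposite side of the line through A and C from B — has two-dimensional Lebesgue measure c^2·(π − 2θ)/8 − a·b/4. -/
open EuclideanGeometry MeasureTheory

theorem integral_two_mul_sqrt_sq_sub_sq {r h : ℝ} (hr : 0 < r) (hh : |h| ≤ r) :
    ∫ x in (-r)..(-h), 2 * √(r ^ 2 - x ^ 2)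
      = r ^ 2 * (Real.pi / 2 - Real.arcsin (h / r)) - h * √(r ^ 2 - h ^ 2) := by
  have hle : -r ≤ -h := neg_le_neg (abs_le.1 hh).2
  have hd : ∀ x ∈ Set.Ioo (-r) (-h),
      HasDerivAt (fun x => x * √(r ^ 2 - x ^ 2) + r ^ 2 * Real.arcsin (x / r))
        (2 * √(r ^ 2 - x ^ 2)) x := by
    intro x hx
    have hxr : x < r := by linarith [hx.2, (abs_le.1 hh).1]
    have hpos : 0 < r ^ 2 - x ^ 2 := by nlinarith [hx.1]
    have hs : 0 < √(r ^ 2 - x ^ 2) := Real.sqrt_pos.2 hpos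
    have hsq : √(r ^ 2 - x ^ 2) ^ 2 = r ^ 2 - x ^ 2 := Real.sq_sqrt hpos.le
    have hroot : √(1 - (x / r) ^ 2) = √(r ^ 2 - x ^ 2) / r := by
      rw [show 1 - (x / r) ^ 2 = (r ^ 2 - x ^ 2) / r ^ 2 by field_simp,
        Real.sqrt_div hpos.le, Real.sqrt_sq hr.le]
    have h1 : HasDerivAt (fun x => r ^ 2 - x ^ 2) (-(2 * x)) x := by
      simpa using ((hasDerivAt_id x).pow 2).const_sub (r ^ 2)
    have h2 := (Real.hasDerivAt_arcsin (x := x / r)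
      (by have := (lt_div_iff₀ hr).2 (show -1 * r < x by linarith [hx.1]); exact this.ne')
      (by have := (div_lt_one hr).2 hxr; exact this.ne)).comp x ((hasDerivAt_id x).div_const r)
    have h3 := ((hasDerivAt_id x).mul (h1.sqrt hpos.ne')).add (h2.const_mul (r ^ 2))
    refine h3.congr_deriv ?_
    rw [hroot]
    simp only [id]
    field_simp
    linear_combination -hsq
  rw [intervalIntegral.integral_eq_sub_of_hasDerivAt_of_le hle
    (Continuous.continuousOn (by fun_prop)) hd (Continuous.intervalIntegrable (by fun_prop) _ _)]
  simp only [neg_sq, sub_self, Real.sqrt_zero, neg_div, div_self hr.ne', Real.arcsin_neg,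
    Real.arcsin_one]
  ring

theorem measurableSet_disc_inter_halfPlane (r h : ℝ) :
    MeasurableSet {p : ℝ × ℝ | p.1 ^ 2 + p.2 ^ 2 ≤ r ^ 2 ∧ p.1 < -h} := by
  have h₁ : MeasurableSet {p : ℝ × ℝ | p.1 ^ 2 + p.2 ^ 2 ≤ r ^ 2} :=
    measurableSet_le (by fun_prop) (by fun_prop)
  have h₂ : MeasurableSet {p : ℝ × ℝ | p.1 < -h} :=
    measurableSet_lt (by fun_prop) (by fun_prop)
  exact h₁.inter h₂

theorem volume_disc_inter_halfPlane {r h : ℝ} (hr : 0 < r) (hh : |h| ≤ r) :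
    volume {p : ℝ × ℝ | p.1 ^ 2 + p.2 ^ 2 ≤ r ^ 2 ∧ p.1 < -h}
      = ENNReal.ofReal
        (r ^ 2 * (Real.pi / 2 - Real.arcsin (h / r)) - h * √(r ^ 2 - h ^ 2)) := by
  have hle : -r ≤ -h := neg_le_neg (abs_le.1 hh).2
  have hslice : ∀ x : ℝ,
      volume (Prod.mk x ⁻¹' {p : ℝ × ℝ | p.1 ^ 2 + p.2 ^ 2 ≤ r ^ 2 ∧ p.1 < -h})
        = (Set.Ioo (-r) (-h)).indicator
          (fun x => ENNReal.ofReal (2 * √(r ^ 2 - x ^ 2))) x := by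
    intro x
    by_cases hx : x ∈ Set.Ioo (-r) (-h)
    · have hpos : 0 ≤ r ^ 2 - x ^ 2 := by nlinarith [hx.1, hx.2, (abs_le.1 hh).1]
      rw [Set.indicator_of_mem hx, two_mul, ← sub_neg_eq_add, ← Real.volume_Icc]
      congr 1
      ext y
      simp only [Set.mem_preimage, Set.mem_ofPred_eq, hx.2, and_true, Set.mem_Icc, ← abs_le]
      rw [Real.le_sqrt (abs_nonneg y) hpos, sq_abs, le_sub_iff_add_le']
    · rw [Set.indicator_of_notMem hx]
      refine measure_mono_null (t := {0}) ?_ (by simp)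
      rintro y ⟨hy, hxh⟩
      have hxr : x ≤ -r := by
        by_contra! hlt
        exact hx ⟨hlt, hxh⟩
      have : y ^ 2 ≤ 0 := by
        simp only at hy
        nlinarith
      simpa using le_antisymm this (sq_nonneg y)
  rw [Measure.volume_eq_prod, Measure.prod_apply (measurableSet_disc_inter_halfPlane r h), lintegral_congr hslice,
    lintegral_indicator measurableSet_Ioo, ← integral_two_mul_sqrt_sq_sub_sq hr hh,
    intervalIntegral.integral_of_le hle, integral_Ioc_eq_integral_Ioo,
    ofReal_integral_eq_lintegral_ofReal]
  · exact (Continuous.integrableOn_Icc (by fun_prop)).mono_set Set.Ioo_subset_Icc_self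
  · exact Filter.Eventually.of_forall fun x => by positivity

theorem measurePreserving_coords (e : OrthonormalBasis (Fin 2) ℝ (EuclideanSpace ℝ (Fin 2)))
    (D : EuclideanSpace ℝ (Fin 2)) :
    MeasurePreserving (fun x => (e.repr (x - D) 0, e.repr (x - D) 1)) :=
  (volume_preserving_finTwoArrow ℝ).comp
    ((EuclideanSpace.volume_preserving_symm_measurableEquiv_toLp (Fin 2)).comp
      (e.measurePreserving_repr.comp (measurePreserving_sub_right volume D)))

theorem exists_orthonormalBasis_of_angle_eq_pi_div_two {A B C : EuclideanSpace ℝ (Fin 2)}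
    (hC : ∠ A C B = Real.pi / 2) (ha : 0 < dist B C) (hb : 0 < dist A C) :
    ∃ e : OrthonormalBasis (Fin 2) ℝ (EuclideanSpace ℝ (Fin 2)),
      B - C = dist B C • e 0 ∧ A - C = dist A C • e 1 := by
  have hin : inner ℝ (A - C) (B - C) = 0 :=
    InnerProductGeometry.inner_eq_zero_iff_angle_eq_pi_div_two _ _ |>.2 hC
  rw [dist_eq_norm] at ha hb
  simp only [dist_eq_norm]
  have hon : Orthonormal ℝ ![‖B - C‖⁻¹ • (B - C), ‖A - C‖⁻¹ • (A - C)] := by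
    rw [orthonormal_iff_ite]
    intro i j
    fin_cases i <;> fin_cases j <;>
      simp [inner_smul_left, inner_smul_right, hin, real_inner_comm (A - C) (B - C),
        real_inner_self_eq_norm_sq, -inner_self_eq_norm_sq_to_K] <;>
      field_simp
  refine ⟨OrthonormalBasis.mk hon
    (hon.linearIndependent.span_eq_top_of_card_eq_finrank' (by simp)).ge, ?_, ?_⟩ <;>
    simp [smul_smul, ha.ne', hb.ne']

theorem sOppSide_affineSpan_pair_iff {A B C : EuclideanSpace ℝ (Fin 2)} {a b : ℝ}
    (ha : 0 < a) (hb : 0 < b) (e : OrthonormalBasis (Fin 2) ℝ (EuclideanSpace ℝ (Fin 2)))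
    (hB : B - C = a • e 0) (hA : A - C = b • e 1) (x : EuclideanSpace ℝ (Fin 2)) :
    (affineSpan ℝ {A, C}).SOppSide x B ↔ e.repr (x - C) 0 < 0 := by
  have hq : ∀ q ∈ affineSpan ℝ {A, C}, e.repr (q - C) 0 = 0 := by
    intro q hq
    obtain ⟨t, ht⟩ := vadd_right_mem_affineSpan_pair.1
      (show (q - C) +ᵥ C ∈ affineSpan ℝ {A, C} by rwa [vadd_eq_add, sub_add_cancel])
    rw [← ht, vsub_eq_sub, hA]
    simp
  have hBs : B ∉ affineSpan ℝ {A, C} := by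
    intro hmem
    have := hq B hmem
    rw [hB] at this
    simp [ha.ne'] at this
  have hset := AffineSubspace.setOfPred_sOppSide_eq_image2 hBs (right_mem_affineSpan_pair ℝ A C)
  rw [AffineSubspace.sOppSide_comm]
  change x ∈ {y | (affineSpan ℝ {A, C}).SOppSide B y} ↔ _
  rw [hset]
  constructor
  · rintro ⟨t, ht, q, hqs, rfl⟩
    have : (t • (B -ᵥ C) +ᵥ q) - C = (t * a) • e 0 + (q - C) := by
      rw [vsub_eq_sub, vadd_eq_add, hB]
      module
    beta_reduce
    rw [this, map_add, PiLp.add_apply, hq q hqs]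
    simpa using mul_neg_of_neg_of_pos ht ha
  · intro hx
    have hsum := e.sum_repr (x - C)
    rw [Fin.sum_univ_two] at hsum
    refine ⟨e.repr (x - C) 0 / a, div_neg_of_neg_of_pos hx ha,
      _, smul_vsub_rev_vadd_mem_affineSpan_pair (e.repr (x - C) 1 / b) A C, ?_⟩
    simp only [vsub_eq_sub, vadd_eq_add, hA, hB, smul_smul,
      div_mul_cancel₀ _ ha.ne', div_mul_cancel₀ _ hb.ne']
    rw [← add_assoc, hsum, sub_add_cancel]

theorem region_A_area
    (A B C D : EuclideanSpace ℝ (Fin 2))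
    (hC : ∠ A C B = Real.pi / 2)
    (ha : 0 < dist B C) (hb : 0 < dist A C)
    (hD : D = midpoint ℝ A B)
    (θ : ℝ) (hθ : θ = ∠ B A C) :
    volume {x : EuclideanSpace ℝ (Fin 2) |
        dist x D ≤ dist A B / 2 ∧ (affineSpan ℝ {A, C}).SOppSide x B}
      = ENNReal.ofReal ((dist A B) ^ 2 * (Real.pi - 2 * θ) / 8
          - dist B C * dist A C / 4) := by
  obtain ⟨e, hB, hA⟩ := exists_orthonormalBasis_of_angle_eq_pi_div_two hC ha hb
  have hpyth : dist A B ^ 2 = dist B C ^ 2 + dist A C ^ 2 := by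
    have := (dist_sq_eq_dist_sq_add_dist_sq_iff_angle_eq_pi_div_two A C B).2 hC
    linarith
  have hθ' : θ = Real.arcsin (dist B C / dist A B) := by
    rw [hθ, angle_comm, angle_eq_arcsin_of_angle_eq_pi_div_two (by rwa [angle_comm])
      (Or.inl (dist_pos.1 ha)), dist_comm B A]
  have hDC : ∀ x, e.repr (x - C) 0 = e.repr (x - D) 0 + dist B C / 2 := by
    intro x
    have : x - C = (x - D) + ((dist B C / 2) • e 0 + (dist A C / 2) • e 1) := by
      rw [div_eq_inv_mul, div_eq_inv_mul, mul_smul, mul_smul, ← hA, ← hB, hD,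
        midpoint_eq_smul_add, invOf_eq_inv]
      module
    rw [this]
    simp
  generalize dist B C = a at *
  generalize dist A C = b at *
  have hc0 : 0 ≤ dist A B := dist_nonneg
  generalize dist A B = c at *
  have hc : 0 < c := by nlinarith [pow_pos ha 2]
  have hac : a ≤ c := by nlinarith
  have hset : {x : EuclideanSpace ℝ (Fin 2) |
        dist x D ≤ c / 2 ∧ (affineSpan ℝ {A, C}).SOppSide x B}
      = (fun x => (e.repr (x - D) 0, e.repr (x - D) 1)) ⁻¹'
        {p : ℝ × ℝ | p.1 ^ 2 + p.2 ^ 2 ≤ (c / 2) ^ 2 ∧ p.1 < -(a / 2)} := by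
    ext x
    have hn : dist x D ^ 2 = e.repr (x - D) 0 ^ 2 + e.repr (x - D) 1 ^ 2 := by
      rw [dist_eq_norm, ← e.repr.norm_map, EuclideanSpace.real_norm_sq_eq, Fin.sum_univ_two]
    simp only [Set.mem_ofPred_eq, Set.mem_preimage, ← hn,
      sOppSide_affineSpan_pair_iff ha hb e hB hA, hDC]
    rw [sq_le_sq₀ dist_nonneg (by positivity), lt_neg_iff_add_neg]
  rw [hset, (measurePreserving_coords e D).measure_preimage
      (measurableSet_disc_inter_halfPlane _ _).nullMeasurableSet,
    volume_disc_inter_halfPlane (by positivity) (by rw [abs_of_pos (by positivity)]; linarith),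
    show (c / 2) ^ 2 - (a / 2) ^ 2 = (b / 2) ^ 2 by linear_combination hpyth / 4,
    Real.sqrt_sq (by positivity), div_div_div_cancel_right₀ two_ne_zero, ← hθ']
  congr 1
  ring
end

section
/- (Region C) Let E be the midpoint of segment AC, G the orthogonal projection of C onto line AB, and θ = ∠ B A C. The circular segment of the circle with center E and radius b/2 cut off by the chord AG, on the side of line AB opposite to C — that is, the set of points x with dist x E ≤ b/2 lying on the opposite side of the line through A and B from C — has two-dimensional Lebesgue measure b^2·(π − 2θ)/8 − a·b^3/(4·c^2). -/
open EuclideanGeometry MeasureTheory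

theorem integral_two_mul_sqrt_sq_sub_sq_s14 {r d : ℝ} (hd : -r < d) (hdr : d ≤ r) (hr : 0 < r) :
    ∫ u in d..r, 2 * √(r ^ 2 - u ^ 2) =
      r ^ 2 * Real.arccos (d / r) - d * √(r ^ 2 - d ^ 2) := by
  rw [intervalIntegral.integral_eq_sub_of_hasDerivAt_of_le
    (f := fun u => u * √(r ^ 2 - u ^ 2) - r ^ 2 * Real.arccos (u / r)) hdr]
  · simp [hr.ne']
  · fun_prop (disch := exact hr.ne')
  · intro u hu
    have hpos : 0 < r ^ 2 - u ^ 2 := by nlinarith [hu.1, hu.2]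
    have h1 : u / r ≠ -1 := by
      rw [Ne, div_eq_iff hr.ne']; linarith [hu.1]
    have h2 : u / r ≠ 1 := by
      rw [Ne, div_eq_iff hr.ne']; linarith [hu.2]
    have hs : √(1 - (u / r) ^ 2) = √(r ^ 2 - u ^ 2) / r := by
      rw [show 1 - (u / r) ^ 2 = (r ^ 2 - u ^ 2) / r ^ 2 by field_simp,
        Real.sqrt_div hpos.le, Real.sqrt_sq hr.le]
    have hsq := Real.sq_sqrt hpos.le
    have hne := (Real.sqrt_pos.2 hpos).ne'
    have hd1 : HasDerivAt (fun u : ℝ => r ^ 2 - u ^ 2) (-(2 * u)) u := by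
      simpa using (hasDerivAt_pow 2 u).const_sub (r ^ 2)
    have key := ((hasDerivAt_id u).mul (hd1.sqrt hpos.ne')).sub
      (((Real.hasDerivAt_arccos h1 h2).comp u ((hasDerivAt_id u).div_const r)).const_mul (r ^ 2))
    refine key.congr_deriv ?_
    rw [hs]
    simp only [id]
    field_simp
    linarith
  · exact Continuous.intervalIntegrable (by fun_prop) _ _

theorem measurableSet_circularSegment_prod (r d : ℝ) :
    MeasurableSet {z : ℝ × ℝ | z.1 ^ 2 + z.2 ^ 2 ≤ r ^ 2 ∧ d < z.1} := by
  measurability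

theorem volume_circularSegment_prod {r d : ℝ} (hd : 0 ≤ d) (hdr : d ≤ r) (hr : 0 < r) :
    volume {z : ℝ × ℝ | z.1 ^ 2 + z.2 ^ 2 ≤ r ^ 2 ∧ d < z.1} =
      ENNReal.ofReal (r ^ 2 * Real.arccos (d / r) - d * √(r ^ 2 - d ^ 2)) := by
  have hslice (u : ℝ) :
      volume (Prod.mk u ⁻¹' {z : ℝ × ℝ | z.1 ^ 2 + z.2 ^ 2 ≤ r ^ 2 ∧ d < z.1}) =
        (Set.Ioc d r).indicator (fun u => ENNReal.ofReal (2 * √(r ^ 2 - u ^ 2))) u := by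
    by_cases hu : u ∈ Set.Ioc d r
    · have hpos : 0 ≤ r ^ 2 - u ^ 2 := by nlinarith [hu.1, hu.2]
      have : Prod.mk u ⁻¹' {z : ℝ × ℝ | z.1 ^ 2 + z.2 ^ 2 ≤ r ^ 2 ∧ d < z.1} =
          Set.Icc (-√(r ^ 2 - u ^ 2)) (√(r ^ 2 - u ^ 2)) := by
        ext v
        rw [Set.mem_Icc, ← abs_le, ← Real.sqrt_sq_eq_abs, Real.sqrt_le_sqrt_iff hpos]
        simp only [Set.mem_preimage, Set.mem_ofPred_eq, hu.1, and_true]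
        exact ⟨fun h => by linarith, fun h => by linarith⟩
      rw [this, Real.volume_Icc, Set.indicator_of_mem hu]
      ring_nf
    · rw [Set.indicator_of_notMem hu]
      convert measure_empty (μ := (volume : Measure ℝ))
      ext v
      simp only [Set.mem_preimage, Set.mem_ofPred_eq, Set.mem_empty_iff_false, iff_false]
      rintro ⟨h, hu'⟩
      exact hu ⟨hu', abs_le_of_sq_le_sq' (by nlinarith [sq_nonneg v]) hr.le |>.2⟩
  rw [Measure.volume_eq_prod, Measure.prod_apply (measurableSet_circularSegment_prod r d)]
  simp_rw [hslice]
  rw [lintegral_indicator measurableSet_Ioc, ← ofReal_integral_eq_lintegral_ofReal,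
    ← intervalIntegral.integral_of_le hdr,
    integral_two_mul_sqrt_sq_sub_sq_s14 (by linarith) hdr hr]
  · exact (Continuous.integrableOn_Ioc (by fun_prop))
  · exact Filter.Eventually.of_forall fun u => by positivity

theorem OrthonormalBasis.volume_circularSegment {V : Type*} [NormedAddCommGroup V]
    [InnerProductSpace ℝ V] [FiniteDimensional ℝ V] [MeasurableSpace V] [BorelSpace V]
    (e : OrthonormalBasis (Fin 2) ℝ V) (p : V) {r d : ℝ}
    (hd : 0 ≤ d) (hdr : d ≤ r) (hr : 0 < r) :
    volume {x : V | dist x p ≤ r ∧ d < inner ℝ (e 0) (x - p)} =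
      ENNReal.ofReal (r ^ 2 * Real.arccos (d / r) - d * √(r ^ 2 - d ^ 2)) := by
  have hmp := (volume_preserving_finTwoArrow ℝ).comp ((PiLp.volume_preserving_ofLp (Fin 2)).comp
    (e.measurePreserving_repr.comp (measurePreserving_sub_right (volume : Measure V) p)))
  rw [← volume_circularSegment_prod hd hdr hr, ← hmp.measure_preimage
      (measurableSet_circularSegment_prod r d).nullMeasurableSet]
  congr 1
  ext x
  have hsum := e.sum_sq_inner_right (x - p)
  rw [Fin.sum_univ_two] at hsum
  simp only [Set.mem_ofPred_eq, Set.mem_preimage, Function.comp_apply,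
    MeasurableEquiv.finTwoArrow_apply, e.repr_apply_apply, hsum, dist_eq_norm]
  rw [pow_le_pow_iff_left₀ (norm_nonneg _) hr.le two_ne_zero]

theorem OrthonormalBasis.mem_line_iff {V : Type*} [NormedAddCommGroup V]
    [InnerProductSpace ℝ V] (e : OrthonormalBasis (Fin 2) ℝ V) {A B : V} (hAB : A ≠ B)
    (h : inner ℝ (e 0) (B - A) = 0) {x : V} :
    x ∈ line[ℝ, A, B] ↔ inner ℝ (e 0) (x - A) = 0 := by
  rw [mem_affineSpan_pair_iff_exists_lineMap_eq]
  constructor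
  · rintro ⟨t, rfl⟩
    simp [AffineMap.lineMap_apply, inner_smul_right, h]
  · intro hx
    have hB := e.sum_repr' (B - A)
    have hX := e.sum_repr' (x - A)
    simp only [Fin.sum_univ_two, h, hx, zero_smul, zero_add] at hB hX
    have hne : inner ℝ (e 1) (B - A) ≠ 0 := by
      intro h0
      rw [h0, zero_smul] at hB
      exact hAB (sub_eq_zero.1 hB.symm).symm
    refine ⟨inner ℝ (e 1) (x - A) / inner ℝ (e 1) (B - A), ?_⟩
    rw [AffineMap.lineMap_apply, vsub_eq_sub, vadd_eq_add]
    nth_rw 2 [← hB]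
    rw [smul_smul, div_mul_cancel₀ _ hne, hX, sub_add_cancel]

theorem OrthonormalBasis.sOppSide_line_iff {V : Type*} [NormedAddCommGroup V]
    [InnerProductSpace ℝ V] (e : OrthonormalBasis (Fin 2) ℝ V) {A B C : V} (hAB : A ≠ B)
    (h : inner ℝ (e 0) (B - A) = 0) (hC : inner ℝ (e 0) (C - A) < 0) {x : V} :
    line[ℝ, A, B].SOppSide x C ↔ 0 < inner ℝ (e 0) (x - A) := by
  have hCmem : C ∉ line[ℝ, A, B] := by
    rw [e.mem_line_iff hAB h]; exact hC.ne
  have himage := AffineSubspace.setOfPred_sOppSide_eq_image2 hCmem (left_mem_affineSpan_pair ℝ A B)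
  rw [AffineSubspace.sOppSide_comm, ← Set.mem_ofPred_eq (p := fun y => line[ℝ, A, B].SOppSide C y),
    himage, Set.mem_image2]
  constructor
  · rintro ⟨t, ht, q, hq, rfl⟩
    have hq' := (e.mem_line_iff hAB h).1 hq
    rw [vsub_eq_sub, vadd_eq_add, add_sub_assoc, inner_add_right, inner_smul_right, hq', add_zero]
    exact mul_pos_of_neg_of_neg ht hC
  · intro hx
    refine ⟨inner ℝ (e 0) (x - A) / inner ℝ (e 0) (C - A), div_neg_of_pos_of_neg hx hC,
      x - (inner ℝ (e 0) (x - A) / inner ℝ (e 0) (C - A)) • (C - A), ?_, by simp⟩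
    rw [SetLike.mem_coe, e.mem_line_iff hAB h, sub_right_comm, inner_sub_right, inner_smul_right,
      div_mul_cancel₀ _ hC.ne, sub_self]

theorem region_C_area
    (A B C G E : EuclideanSpace ℝ (Fin 2))
    (hC : ∠ A C B = Real.pi / 2)
    (ha : 0 < dist B C) (hb : 0 < dist A C)
    (hG : G = EuclideanGeometry.orthogonalProjection (affineSpan ℝ {A, B}) C)
    (hE : E = midpoint ℝ A C)
    (θ : ℝ) (hθ : θ = ∠ B A C) :
    volume {x : EuclideanSpace ℝ (Fin 2) |
        dist x E ≤ dist A C / 2 ∧ (affineSpan ℝ {A, B}).SOppSide x C}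
      = ENNReal.ofReal ((dist A C) ^ 2 * (Real.pi - 2 * θ) / 8
          - dist B C * (dist A C) ^ 3 / (4 * (dist A B) ^ 2)) := by
  have hpyth := (dist_sq_eq_dist_sq_add_dist_sq_iff_angle_eq_pi_div_two A C B).2 hC
  have hinner : inner ℝ (A - C) (B - C) = (0 : ℝ) :=
    InnerProductGeometry.inner_eq_zero_iff_angle_eq_pi_div_two _ _ |>.2 hC
  have hθ' : θ = Real.arcsin (dist B C / dist A B) := by
    rw [hθ, angle_comm, dist_comm A B]
    exact angle_eq_arcsin_of_angle_eq_pi_div_two (by rwa [angle_comm]) (.inl (dist_pos.1 ha))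
  have hpp : inner ℝ (A - C) (A - C) = dist A C ^ 2 := by
    rw [real_inner_self_eq_norm_sq, dist_eq_norm]
  have hqq : inner ℝ (B - C) (B - C) = dist B C ^ 2 := by
    rw [real_inner_self_eq_norm_sq, dist_eq_norm]
  have hinner' : inner ℝ (B - C) (A - C) = (0 : ℝ) := by rw [real_inner_comm, hinner]
  have hc : 0 < dist A B := by
    refine lt_of_le_of_ne dist_nonneg fun h => ?_
    rw [← h] at hpyth
    nlinarith
  set a := dist B C
  set b := dist A C
  set c := dist A B
  set n := (a * b * c)⁻¹ • (a ^ 2 • (A - C) + b ^ 2 • (B - C)) with hn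
  have hnA : inner ℝ n (A - C) = a * b / c := by
    rw [hn, inner_smul_left, inner_add_left, inner_smul_left, inner_smul_left, hpp, hinner']
    simp only [conj_trivial]
    field_simp
    ring
  have hnB : inner ℝ n (B - C) = a * b / c := by
    rw [hn, inner_smul_left, inner_add_left, inner_smul_left, inner_smul_left, hqq, hinner]
    simp only [conj_trivial]
    field_simp
    ring
  have hnn : ‖n‖ = 1 := by
    rw [← pow_eq_one_iff_of_nonneg (norm_nonneg _) two_ne_zero, ← real_inner_self_eq_norm_sq]
    nth_rw 2 [hn]
    rw [inner_smul_right, inner_add_right, inner_smul_right, inner_smul_right, hnA, hnB]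
    field_simp
    linarith
  obtain ⟨e, he⟩ := Orthonormal.exists_orthonormalBasis_extension_of_card_eq (𝕜 := ℝ)
    (E := EuclideanSpace ℝ (Fin 2)) (ι := Fin 2) (by simp) (v := fun _ => n) (s := {0})
    ⟨fun _ => hnn, fun i j hij => absurd (Subsingleton.elim i j) hij⟩
  have he0 : e 0 = n := he 0 rfl
  have hBA : inner ℝ (e 0) (B - A) = 0 := by
    rw [he0, ← sub_sub_sub_cancel_right B A C, inner_sub_right, hnA, hnB, sub_self]
  have hCA : inner ℝ (e 0) (C - A) < 0 := by
    rw [he0, ← neg_sub, inner_neg_right, hnA, neg_lt_zero]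
    positivity
  have hac : a ≤ c := by nlinarith
  have hset : {x | dist x E ≤ b / 2 ∧ line[ℝ, A, B].SOppSide x C} =
      {x | dist x E ≤ b / 2 ∧ a * b / (2 * c) < inner ℝ (e 0) (x - E)} := by
    ext x
    rw [Set.mem_ofPred_eq, Set.mem_ofPred_eq, e.sOppSide_line_iff (dist_pos.1 hc) hBA hCA]
    have hxE : x - E = (x - A) + (2⁻¹ : ℝ) • (A - C) := by
      rw [hE, midpoint_eq_smul_add, invOf_eq_inv]
      module
    have hval : (2⁻¹ : ℝ) * (a * b / c) = a * b / (2 * c) := by field_simp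
    rw [hxE, inner_add_right, inner_smul_right, he0, hnA, hval, lt_add_iff_pos_left]
  have hratio : a * b / (2 * c) / (b / 2) = a / c := by field_simp
  have hsqrt : √((b / 2) ^ 2 - (a * b / (2 * c)) ^ 2) = b ^ 2 / (2 * c) := by
    rw [← Real.sqrt_sq (show 0 ≤ b ^ 2 / (2 * c) by positivity)]
    congr 1
    field_simp
    linear_combination hpyth
  rw [hset, e.volume_circularSegment E (by positivity) _ (by positivity), hratio, hsqrt,
    Real.arccos, ← hθ']
  · congr 1
    field_simp
    ring
  · rw [div_le_div_iff₀ (by positivity) two_pos]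
    nlinarith
end

section
/- (Region D) Let E be the midpoint of segment AC, G the orthogonal projection of C onto line AB, and θ = ∠ B A C. The circular segment of the circle with center E and radius b/2 cut off by the chord CG, on the side of line CG opposite to A — that is, the set of points x with dist x E ≤ b/2 lying on the opposite side of the line through C and G from A — has two-dimensional Lebesgue measure b^2·θ/4 − a·b^3/(4·c^2). -/
open EuclideanGeometry MeasureTheory

theorem integral_two_mul_sqrt_sq_sub_sq_s15 {r θ : ℝ} (hr : 0 ≤ r) (h0 : 0 ≤ θ) (hπ : θ ≤ Real.pi) :
    ∫ t in (r * Real.cos θ)..r, 2 * √(r ^ 2 - t ^ 2)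
      = r ^ 2 * (θ - Real.sin θ * Real.cos θ) := by
  have key := intervalIntegral.integral_comp_mul_deriv (a := θ) (b := 0)
    (f := fun φ => r * Real.cos φ) (f' := fun φ => r * -Real.sin φ)
    (g := fun t => 2 * √(r ^ 2 - t ^ 2))
    (fun x _ => (Real.hasDerivAt_cos x).const_mul r) (by fun_prop) (by fun_prop)
  simp only [Real.cos_zero, mul_one] at key
  rw [← key, intervalIntegral.integral_symm, ← intervalIntegral.integral_neg]
  have hsub : ∫ φ in (0 : ℝ)..θ,
        -(((fun t => 2 * √(r ^ 2 - t ^ 2)) ∘ fun φ => r * Real.cos φ) φ * (r * -Real.sin φ))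
      = ∫ φ in (0 : ℝ)..θ, 2 * r ^ 2 * Real.sin φ ^ 2 := by
    refine intervalIntegral.integral_congr fun φ hφ => ?_
    rw [Set.uIcc_of_le h0] at hφ
    have hs : 0 ≤ Real.sin φ := Real.sin_nonneg_of_nonneg_of_le_pi hφ.1 (hφ.2.trans hπ)
    have hsq : r ^ 2 - (r * Real.cos φ) ^ 2 = (r * Real.sin φ) ^ 2 := by
      rw [mul_pow, mul_pow, Real.sin_sq]; ring
    simp only [Function.comp_apply, hsq, Real.sqrt_sq (mul_nonneg hr hs)]
    ring
  rw [hsub, intervalIntegral.integral_const_mul, integral_sin_sq]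
  simp only [Real.sin_zero, Real.cos_zero]
  ring

theorem measurableSet_prod_disk_inter_halfPlane (r s : ℝ) :
    MeasurableSet {p : ℝ × ℝ | p.1 ^ 2 + p.2 ^ 2 ≤ r ^ 2 ∧ s < p.1} := by
  rw [Set.ofPred_and]
  exact (measurableSet_le (by fun_prop) (by fun_prop)).inter
    (measurableSet_lt (by fun_prop) (by fun_prop))

theorem volume_prod_disk_inter_halfPlane {r θ : ℝ} (hr : 0 ≤ r) (h0 : 0 ≤ θ)
    (hπ : θ ≤ Real.pi) :
    volume {p : ℝ × ℝ | p.1 ^ 2 + p.2 ^ 2 ≤ r ^ 2 ∧ r * Real.cos θ < p.1}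
      = ENNReal.ofReal (r ^ 2 * (θ - Real.sin θ * Real.cos θ)) := by
  have hle : r * Real.cos θ ≤ r := mul_le_of_le_one_right hr (Real.cos_le_one θ)
  have hge : -r ≤ r * Real.cos θ := by nlinarith [Real.neg_one_le_cos θ]
  rw [Measure.volume_eq_prod,
    Measure.prod_apply (measurableSet_prod_disk_inter_halfPlane r _)]
  have hslice : (fun t : ℝ => volume (Prod.mk t ⁻¹'
        {p : ℝ × ℝ | p.1 ^ 2 + p.2 ^ 2 ≤ r ^ 2 ∧ r * Real.cos θ < p.1}))
      = (Set.Ioc (r * Real.cos θ) r).indicator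
          fun t => ENNReal.ofReal (2 * √(r ^ 2 - t ^ 2)) := by
    funext t
    by_cases ht : t ∈ Set.Ioc (r * Real.cos θ) r
    · have hnn : 0 ≤ r ^ 2 - t ^ 2 := by nlinarith [ht.1, ht.2]
      have hset : Prod.mk t ⁻¹' {p : ℝ × ℝ | p.1 ^ 2 + p.2 ^ 2 ≤ r ^ 2 ∧ r * Real.cos θ < p.1}
          = Set.Icc (-√(r ^ 2 - t ^ 2)) (√(r ^ 2 - t ^ 2)) := by
        ext y
        simp only [Set.mem_preimage, Set.mem_ofPred_eq, Set.mem_Icc, ht.1, and_true]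
        rw [← abs_le, Real.le_sqrt (abs_nonneg y) hnn, sq_abs]
        constructor <;> intro h <;> linarith
      rw [Set.indicator_of_mem ht, hset, Real.volume_Icc]
      congr 1
      ring
    · rw [Set.indicator_of_notMem ht]
      convert measure_empty (μ := (volume : Measure ℝ))
      ext y
      simp only [Set.mem_preimage, Set.mem_ofPred_eq, Set.mem_empty_iff_false, iff_false]
      rintro ⟨h1, h2⟩
      exact ht ⟨h2, abs_le_of_sq_le_sq' (by nlinarith [sq_nonneg y]) hr |>.2⟩
  rw [hslice, lintegral_indicator measurableSet_Ioc, ← ofReal_integral_eq_lintegral_ofReal,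
    ← intervalIntegral.integral_of_le hle, integral_two_mul_sqrt_sq_sub_sq_s15 hr h0 hπ]
  · exact (Continuous.integrableOn_Icc (by fun_prop)).mono_set Set.Ioc_subset_Icc_self
  · exact Filter.Eventually.of_forall fun t => by positivity

theorem volume_circularSegment (E u : EuclideanSpace ℝ (Fin 2)) (hu : ‖u‖ = 1) {r θ : ℝ}
    (hr : 0 ≤ r) (h0 : 0 ≤ θ) (hπ : θ ≤ Real.pi) :
    volume {x : EuclideanSpace ℝ (Fin 2) | dist x E ≤ r ∧ r * Real.cos θ < inner ℝ u (x - E)}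
      = ENNReal.ofReal (r ^ 2 * (θ - Real.sin θ * Real.cos θ)) := by
  obtain ⟨b, hb⟩ := Orthonormal.exists_orthonormalBasis_extension_of_card_eq
    (𝕜 := ℝ) (E := EuclideanSpace ℝ (Fin 2)) (ι := Fin 2) (by simp)
    (v := fun _ => u) (s := {0}) (by
      constructor
      · intro i; simpa using hu
      · intro i j hij; exact absurd (Subsingleton.elim i j) hij)
  have hb0 : b 0 = u := hb 0 rfl
  have hmp := (((volume_preserving_finTwoArrow ℝ).comp
    (EuclideanSpace.volume_preserving_symm_measurableEquiv_toLp (Fin 2))).comp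
    b.measurePreserving_repr).comp (measurePreserving_sub_right volume E)
  rw [← volume_prod_disk_inter_halfPlane hr h0 hπ,
    ← hmp.measure_preimage
      (measurableSet_prod_disk_inter_halfPlane r _).nullMeasurableSet]
  congr 1
  ext x
  have hnorm : ‖x - E‖ ^ 2 = b.repr (x - E) 0 ^ 2 + b.repr (x - E) 1 ^ 2 := by
    rw [← b.repr.norm_map, EuclideanSpace.norm_sq_eq]
    simp
  have hcoord : b.repr (x - E) 0 = inner ℝ u (x - E) := by
    rw [b.repr_apply_apply, hb0]
  change _ ↔ b.repr (x - E) 0 ^ 2 + b.repr (x - E) 1 ^ 2 ≤ r ^ 2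
    ∧ r * Real.cos θ < b.repr (x - E) 0
  rw [Set.mem_ofPred_eq, dist_eq_norm, ← hnorm, hcoord, sq_le_sq₀ (norm_nonneg _) hr]

theorem mem_affineSpan_pair_iff_inner_eq_zero {C G x n : EuclideanSpace ℝ (Fin 2)}
    (hn : n ≠ 0) (hCG : G ≠ C) (h : inner ℝ n (G - C) = 0) :
    x ∈ affineSpan ℝ {C, G} ↔ inner ℝ n (x - C) = 0 := by
  rw [← AffineSubspace.vsub_right_mem_direction_iff_mem (left_mem_affineSpan_pair ℝ C G),
    direction_affineSpan, mem_vectorSpan_pair_rev]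
  simp only [vsub_eq_sub]
  constructor
  · rintro ⟨k, hk⟩
    rw [← hk, inner_smul_right, h, mul_zero]
  · intro hx
    have hw : G - C ≠ 0 := sub_ne_zero.mpr hCG
    generalize x - C = v at *
    generalize G - C = w at *
    have hw2 : w 0 ^ 2 + w 1 ^ 2 ≠ 0 := by
      have := pow_ne_zero 2 (norm_ne_zero_iff.mpr hw)
      rw [EuclideanSpace.norm_sq_eq] at this
      simpa using this
    have hn2 : n 0 ^ 2 + n 1 ^ 2 ≠ 0 := by
      have := pow_ne_zero 2 (norm_ne_zero_iff.mpr hn)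
      rw [EuclideanSpace.norm_sq_eq] at this
      simpa using this
    simp only [PiLp.inner_apply, Fin.sum_univ_two, RCLike.inner_apply, conj_trivial] at h hx
    have hdet : v 0 * w 1 - v 1 * w 0 = 0 := by
      refine (mul_eq_zero.mp ?_).resolve_left hn2
      linear_combination (n 0 * w 1 - n 1 * w 0) * hx + (n 1 * v 0 - n 0 * v 1) * h
    refine ⟨(v 0 * w 0 + v 1 * w 1) / (w 0 ^ 2 + w 1 ^ 2), ?_⟩
    ext i
    fin_cases i
    · simp only [PiLp.smul_apply, smul_eq_mul, Fin.zero_eta]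
      field_simp
      linear_combination (-w 1) * hdet
    · simp only [PiLp.smul_apply, smul_eq_mul, Fin.mk_one]
      field_simp
      linear_combination (w 0) * hdet

theorem sOppSide_affineSpan_pair_iff_s15 {A C G x n : EuclideanSpace ℝ (Fin 2)}
    (hCG : G ≠ C) (h : inner ℝ n (G - C) = 0) (hA : inner ℝ n (A - C) < 0) :
    (affineSpan ℝ {C, G}).SOppSide x A ↔ 0 < inner ℝ n (x - C) := by
  have hn : n ≠ 0 := by
    rintro rfl
    simp at hA
  have hmem (y : EuclideanSpace ℝ (Fin 2)) :=
    mem_affineSpan_pair_iff_inner_eq_zero (x := y) hn hCG h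
  constructor
  · rintro ⟨⟨p, hp, q, hq, hray⟩, hx, -⟩
    rw [hmem] at hp hq hx
    have hxp : inner ℝ n (x - p) = inner ℝ n (x - C) := by
      rw [← sub_sub_sub_cancel_right x p C, inner_sub_right, hp, sub_zero]
    have hqA : inner ℝ n (q - A) = -inner ℝ n (A - C) := by
      rw [← sub_sub_sub_cancel_right q A C, inner_sub_right, hq, zero_sub]
    refine lt_of_le_of_ne ?_ (Ne.symm hx)
    simp only [vsub_eq_sub] at hray
    rcases hray with h1 | h1 | ⟨s, t, hs, ht, h1⟩
    · rw [← hxp, h1, inner_zero_right]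
    · rw [h1, inner_zero_right] at hqA
      linarith
    · have h2 := congrArg (inner ℝ n) h1
      rw [inner_smul_right, inner_smul_right, hxp, hqA] at h2
      by_contra! hneg
      nlinarith [mul_neg_of_pos_of_neg hs hneg, mul_neg_of_pos_of_neg ht hA]
  · intro hx
    refine ⟨?_, by rw [hmem]; exact hx.ne', by rw [hmem]; exact hA.ne⟩
    set α := inner ℝ n (x - C)
    set β := inner ℝ n (A - C)
    have hd : 0 < α - β := by linarith
    have hw : Wbtw ℝ x (AffineMap.lineMap x A (α / (α - β))) A :=
      ⟨α / (α - β), ⟨by positivity, by rw [div_le_one hd]; linarith⟩, rfl⟩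
    refine hw.wOppSide₁₃ ?_
    rw [hmem, AffineMap.lineMap_apply, vsub_eq_sub, vadd_eq_add,
      show (α / (α - β)) • (A - x) + x - C
        = (α / (α - β)) • ((A - C) - (x - C)) + (x - C) by module,
      inner_add_right, inner_smul_right, inner_sub_right]
    change α / (α - β) * (β - α) + α = 0
    field_simp
    ring

theorem region_D_area
    (A B C G E : EuclideanSpace ℝ (Fin 2))
    (hC : ∠ A C B = Real.pi / 2)
    (ha : 0 < dist B C) (hb : 0 < dist A C)
    (hG : G = EuclideanGeometry.orthogonalProjection (affineSpan ℝ {A, B}) C)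
    (hE : E = midpoint ℝ A C)
    (θ : ℝ) (hθ : θ = ∠ B A C) :
    volume {x : EuclideanSpace ℝ (Fin 2) |
        dist x E ≤ dist A C / 2 ∧ (affineSpan ℝ {C, G}).SOppSide x A}
      = ENNReal.ofReal ((dist A C) ^ 2 * θ / 4
          - dist B C * (dist A C) ^ 3 / (4 * (dist A B) ^ 2)) := by
  have hC' : ∠ B C A = Real.pi / 2 := by rwa [angle_comm]
  have hcos := cos_angle_mul_dist_of_angle_eq_pi_div_two hC'
  have hsin := sin_angle_mul_dist_of_angle_eq_pi_div_two hC'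
  rw [angle_comm, ← hθ, dist_comm B A] at hcos hsin
  have hAB : A ≠ B := by
    rintro rfl
    rw [dist_self, mul_zero] at hcos
    exact hb.ne hcos
  have hc : 0 < dist A B := dist_pos.mpr hAB
  have hperp : inner ℝ (A - C) (B - C) = 0 :=
    InnerProductGeometry.inner_eq_zero_iff_angle_eq_pi_div_two _ _ |>.mpr hC
  have hnA : inner ℝ (B - A) (A - C) = -(dist A C) ^ 2 := by
    rw [← sub_sub_sub_cancel_right B A C, inner_sub_left, real_inner_comm, hperp,
      real_inner_self_eq_norm_sq, dist_eq_norm, zero_sub]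
  have hnG : inner ℝ (B - A) (G - C) = 0 := by
    rw [hG]
    refine Submodule.inner_right_of_mem_orthogonal ?_
      (orthogonalProjection_vsub_mem_direction_orthogonal (affineSpan ℝ {A, B}) C)
    exact AffineSubspace.vsub_mem_direction (right_mem_affineSpan_pair ℝ A B)
      (left_mem_affineSpan_pair ℝ A B)
  have hCG : G ≠ C := by
    intro h
    have hmem : C ∈ affineSpan ℝ {A, B} := by
      rw [← h, hG]
      exact orthogonalProjection_mem C
    rw [← AffineSubspace.vsub_right_mem_direction_iff_mem (left_mem_affineSpan_pair ℝ A B),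
      direction_affineSpan, mem_vectorSpan_pair_rev] at hmem
    obtain ⟨t, ht⟩ := hmem
    simp only [vsub_eq_sub] at ht
    have h1 : A - C = (-t) • (B - A) := by rw [neg_smul, ht, neg_sub]
    have h2 : B - C = (1 - t) • (B - A) := by rw [sub_smul, ht, one_smul, sub_sub_sub_cancel_right]
    rw [h1, h2, inner_smul_left, inner_smul_right, real_inner_self_eq_norm_sq] at hperp
    simp only [conj_trivial, mul_eq_zero, pow_eq_zero_iff, norm_eq_zero, ne_eq,
      OfNat.ofNat_ne_zero, not_false_eq_true, sub_eq_zero] at hperp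
    rcases hperp with h3 | h3 | h3
    · rw [h3, zero_smul] at h1
      exact (dist_pos.mp hb) (sub_eq_zero.mp h1)
    · rw [← h3, sub_self, zero_smul] at h2
      exact (dist_pos.mp ha) (sub_eq_zero.mp h2)
    · exact hAB h3.symm
  have hu : ‖(dist A B)⁻¹ • (B - A)‖ = 1 := by
    rw [norm_smul, ← dist_eq_norm, dist_comm B A, norm_inv, Real.norm_of_nonneg hc.le,
      inv_mul_cancel₀ hc.ne']
  have hcos' : Real.cos θ = dist A C / dist A B := by rw [eq_div_iff hc.ne', hcos]
  have hsin' : Real.sin θ = dist B C / dist A B := by rw [eq_div_iff hc.ne', hsin]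
  have hvol := volume_circularSegment E _ hu (r := dist A C / 2) (by positivity)
    (hθ ▸ angle_nonneg B A C) (hθ ▸ angle_le_pi B A C)
  convert hvol using 2
  · ext x
    rw [Set.mem_ofPred_eq, Set.mem_ofPred_eq,
      sOppSide_affineSpan_pair_iff_s15 hCG hnG (by rw [hnA]; nlinarith)]
    refine and_congr_right fun _ => ?_
    have hxE : x - E = (x - C) - (1 / 2 : ℝ) • (A - C) := by
      rw [hE, midpoint_eq_smul_add, invOf_eq_inv]
      module
    rw [hxE, inner_smul_left, inner_sub_right _ (x - C), inner_smul_right, hnA, hcos', conj_trivial,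
      ← div_eq_inv_mul, ← mul_div_assoc, div_lt_div_iff_of_pos_right hc]
    constructor <;> intro h <;> linarith
  · rw [hcos', hsin']
    field_simp
    ring
end

section
/- (Semicircle decomposition identity) Let D, E, F be the midpoints of segments AB, AC, BC respectively, and G the orthogonal projection of C onto line AB. Define: S_c as the set of points x with dist x D ≤ c/2 on the same side of line AB as C; S_b as the set of points x with dist x E ≤ b/2 on the same side of line AC as B; S_a as the set of points x with dist x F ≤ a/2 on the same side of line BC as A; Region A (resp. B) as the set of points x with dist x D ≤ c/2 on the opposite side of line AC (resp. line BC) from B (resp. A); Region C as the points x with dist x E ≤ b/2 on the opposite side of line AB from C; Region D as the points x with dist x E ≤ b/2 on the opposite side of line CG from A; Region E as the points x with dist x F ≤ a/2 on the opposite side of line CG from B; Region F as the points x with dist x F ≤ a/2 on the opposite side of line AB from C. Then the two-dimensional Lebesgue measures satisfy vol(S_c) = vol(S_a) + vol(S_b) + vol(Region A) + vol(Region B) − vol(Region C) − vol(Region D) − vol(Region E) − vol(Region F). -/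
open EuclideanGeometry MeasureTheory

/-- In a right triangle with right angle at `C` and altitude foot `G`, the triangle `A C G` is the
image of `A B C` under a similarity of the plane with ratio `dist A C / dist A B`. -/
lemma exists_similarity_of_angle_eq_pi_div_two {A B C G : EuclideanSpace ℝ (Fin 2)}
    (hb : 0 < dist A C) (hc : 0 < dist A B)
    (hG : G = AffineMap.lineMap A B (dist A C ^ 2 / dist A B ^ 2)) :
    ∃ f : EuclideanSpace ℝ (Fin 2) ≃ᵃ[ℝ] EuclideanSpace ℝ (Fin 2),
      (∀ x y, dist (f x) (f y) = dist A C / dist A B * dist x y) ∧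
      f A = A ∧ f B = C ∧ f C = G ∧
      ∀ s : Set (EuclideanSpace ℝ (Fin 2)),
        volume (f '' s) = ENNReal.ofReal ((dist A C / dist A B) ^ 2) * volume s := by
  set b := dist A C
  set c := dist A B
  set k := b / c with hk
  have hk0 : 0 < k := div_pos hb hc
  set u := b • (B - A)
  set v := c • (C - A)
  have huv : ‖u‖ = ‖v‖ := by
    simp only [u, v, norm_smul, Real.norm_eq_abs, abs_of_pos hb, abs_of_pos hc]
    rw [← dist_eq_norm, ← dist_eq_norm, dist_comm B, dist_comm C, mul_comm]
  let R := (Submodule.span ℝ {u - v})ᗮ.reflection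
  have hRu : R u = v := Submodule.reflection_sub huv
  have hRv : R v = u := by rw [← hRu]; exact Submodule.reflection_reflection _ _
  have hRB : R (B - A) = (c / b) • (C - A) := by
    have h : B - A = b⁻¹ • u := by simp only [u]; rw [smul_smul, inv_mul_cancel₀ hb.ne', one_smul]
    rw [h, map_smul, hRu, smul_smul, inv_mul_eq_div]
  have hRC : R (C - A) = (b / c) • (B - A) := by
    have h : C - A = c⁻¹ • v := by simp only [v]; rw [smul_smul, inv_mul_cancel₀ hc.ne', one_smul]
    rw [h, map_smul, hRv, smul_smul, inv_mul_eq_div]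
  let f : EuclideanSpace ℝ (Fin 2) ≃ᵃ[ℝ] EuclideanSpace ℝ (Fin 2) :=
    ((AffineEquiv.vaddConst ℝ A).symm.trans
      (R.toLinearEquiv.trans (LinearEquiv.smulOfNeZero ℝ _ k hk0.ne')).toAffineEquiv).trans
      (AffineEquiv.vaddConst ℝ A)
  have hf : ∀ x, f x = k • R (x - A) + A := fun x => rfl
  refine ⟨f, fun x y => ?_, ?_, ?_, ?_, fun s => ?_⟩
  · rw [hf, hf, dist_add_right, dist_smul₀, R.dist_map, dist_sub_right, Real.norm_of_nonneg hk0.le]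
  · simp [hf]
  · rw [hf, hRB, smul_smul, hk, div_mul_div_cancel₀ hc.ne', div_self hb.ne', one_smul,
      sub_add_cancel]
  · rw [hf, hRC, hG, AffineMap.lineMap_apply, smul_smul, hk, ← sq, div_pow]
    rfl
  · have himage : f '' s =
        AffineMap.homothety A k '' ((fun x => A + x) '' (R '' ((fun x => -A + x) '' s))) := by
      simp only [Set.image_image]
      refine Set.image_congr fun x _ => ?_
      simp [hf, AffineMap.homothety_apply, sub_eq_neg_add]
    have hR : ∀ t : Set (EuclideanSpace ℝ (Fin 2)), volume (R '' t) = volume t := fun t => by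
      rw [LinearIsometryEquiv.image_eq_preimage_symm]
      exact R.symm.measurePreserving.measure_preimage_equiv (f := R.symm.toMeasurableEquiv) t
    rw [himage, Measure.addHaar_image_homothety, Set.image_add_left, measure_preimage_add, hR,
      Set.image_add_left, measure_preimage_add, finrank_euclideanSpace_fin,
      abs_of_nonneg (sq_nonneg k)]

lemma image_similarity_setOf_dist_le {f : EuclideanSpace ℝ (Fin 2) ≃ᵃ[ℝ] EuclideanSpace ℝ (Fin 2)}
    {k : ℝ} (hk : 0 < k) (hf : ∀ x y, dist (f x) (f y) = k * dist x y)
    (P Q : EuclideanSpace ℝ (Fin 2)) {p q : EuclideanSpace ℝ (Fin 2) → Prop}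
    (hpq : ∀ x, q (f x) ↔ p x) :
    f '' {x | dist x (midpoint ℝ P Q) ≤ dist P Q / 2 ∧ p x} =
      {x | dist x (midpoint ℝ (f P) (f Q)) ≤ dist (f P) (f Q) / 2 ∧ q x} := by
  ext y
  obtain ⟨x, rfl⟩ := f.surjective y
  rw [f.injective.mem_set_image]
  simp only [Set.mem_ofPred_eq, hpq, ← AffineEquiv.map_midpoint, hf, mul_div_assoc,
    mul_le_mul_iff_right₀ hk]

/-- The half disk on the hypotenuse `AB` and the two disk segments cut off by the legs are similar
to the half disk on `AC` and the disk segments cut off from it by the altitude from `C`. -/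
lemma volume_halfDisk_and_segments_of_similarity {A B C G : EuclideanSpace ℝ (Fin 2)}
    (hb : 0 < dist A C) (hc : 0 < dist A B) (hB : B ∉ affineSpan ℝ {A, C})
    (hG : G = AffineMap.lineMap A B (dist A C ^ 2 / dist A B ^ 2)) :
    volume {x | dist x (midpoint ℝ A C) ≤ dist A C / 2 ∧ (affineSpan ℝ {A, C}).SSameSide x B} =
      ENNReal.ofReal ((dist A C / dist A B) ^ 2) * volume
        {x | dist x (midpoint ℝ A B) ≤ dist A B / 2 ∧ (affineSpan ℝ {A, B}).SSameSide x C} ∧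
    volume {x | dist x (midpoint ℝ A C) ≤ dist A C / 2 ∧ (affineSpan ℝ {A, B}).SOppSide x C} =
      ENNReal.ofReal ((dist A C / dist A B) ^ 2) * volume
        {x | dist x (midpoint ℝ A B) ≤ dist A B / 2 ∧ (affineSpan ℝ {A, C}).SOppSide x B} ∧
    volume {x | dist x (midpoint ℝ A C) ≤ dist A C / 2 ∧ (affineSpan ℝ {C, G}).SOppSide x A} =
      ENNReal.ofReal ((dist A C / dist A B) ^ 2) * volume
        {x | dist x (midpoint ℝ A B) ≤ dist A B / 2 ∧ (affineSpan ℝ {B, C}).SOppSide x A} := by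
  obtain ⟨f, hf, hfA, hfB, hfC, hvol⟩ := exists_similarity_of_angle_eq_pi_div_two hb hc hG
  have ht : 0 < dist A C ^ 2 / dist A B ^ 2 := by positivity
  have hmap : ∀ P Q, (affineSpan ℝ {P, Q}).map (f : _ →ᵃ[ℝ] _) = affineSpan ℝ {f P, f Q} :=
    fun P Q => by rw [AffineSubspace.map_span, Set.image_pair]; rfl
  have hGB : (affineSpan ℝ {A, C}).SSameSide G B := by
    rw [hG]
    exact AffineSubspace.sSameSide_lineMap_left (left_mem_affineSpan_pair ℝ A C) hB ht
  have hGspan : affineSpan ℝ {A, G} = affineSpan ℝ {A, B} := by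
    refine le_antisymm
      (affineSpan_pair_le_of_mem_of_mem (left_mem_affineSpan_pair ℝ A B) ?_)
      (affineSpan_pair_le_of_mem_of_mem (left_mem_affineSpan_pair ℝ A G) ?_)
    · rw [hG]
      exact AffineMap.lineMap_mem_affineSpan_pair _ _ _
    · have h : B = AffineMap.lineMap A G (dist A C ^ 2 / dist A B ^ 2)⁻¹ := by
        rw [hG, AffineMap.lineMap_apply A, AffineMap.lineMap_vsub_left, smul_smul,
          inv_mul_cancel₀ ht.ne', one_smul, vsub_vadd]
      rw [h]
      exact AffineMap.lineMap_mem_affineSpan_pair _ _ _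
  have key : ∀ {p q : EuclideanSpace ℝ (Fin 2) → Prop}, (∀ x, q (f x) ↔ p x) →
      volume {x | dist x (midpoint ℝ A C) ≤ dist A C / 2 ∧ q x} =
        ENNReal.ofReal ((dist A C / dist A B) ^ 2) *
          volume {x | dist x (midpoint ℝ A B) ≤ dist A B / 2 ∧ p x} := fun hpq => by
    rw [← hvol, image_similarity_setOf_dist_le (div_pos hb hc) hf A B hpq, hfA, hfB]
  refine ⟨key fun x => ?_, key fun x => ?_, key fun x => ?_⟩
  · rw [← f.sSameSide_map_iff (s := affineSpan ℝ {A, B}), hmap, hfA, hfB, hfC]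
    exact ⟨fun h => h.trans hGB.symm, fun h => h.trans hGB⟩
  · rw [← f.sOppSide_map_iff (s := affineSpan ℝ {A, C}), hmap, hfA, hfB, hfC, hGspan]
  · rw [← f.sOppSide_map_iff (s := affineSpan ℝ {B, C}), hmap, hfA, hfB, hfC]

/-- The foot of the altitude to the hypotenuse divides it in the ratio of the squared legs. -/
lemma coe_orthogonalProjection_line_eq_lineMap_of_angle_eq_pi_div_two
    {V P : Type*} [NormedAddCommGroup V] [InnerProductSpace ℝ V] [MetricSpace P]
    [NormedAddTorsor V P] {A B C : P} (hC : ∠ A C B = Real.pi / 2) (hc : 0 < dist A B) :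
    (orthogonalProjection (affineSpan ℝ {A, B}) C : P) =
      AffineMap.lineMap A B (dist A C ^ 2 / dist A B ^ 2) := by
  rw [coe_orthogonalProjection_eq_iff_mem]
  refine ⟨AffineMap.lineMap_mem_affineSpan_pair _ _ _, ?_⟩
  rw [direction_affineSpan, vectorSpan_pair_rev, Submodule.mem_orthogonal_singleton_iff_inner_left]
  have h0 : inner ℝ (A -ᵥ C) (B -ᵥ C) = 0 :=
    (InnerProductGeometry.inner_eq_zero_iff_angle_eq_pi_div_two _ _).2 hC
  have hCG : C -ᵥ AffineMap.lineMap A B (dist A C ^ 2 / dist A B ^ 2) =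
      -(A -ᵥ C) - (dist A C ^ 2 / dist A B ^ 2) • (B -ᵥ A) := by
    rw [AffineMap.lineMap_apply, vsub_vadd_eq_vsub_sub, neg_vsub_eq_vsub_rev]
  have hBA : inner ℝ (A -ᵥ C) (B -ᵥ A) = -dist A C ^ 2 := by
    rw [← vsub_sub_vsub_cancel_right B A C, inner_sub_right, h0, real_inner_self_eq_norm_sq,
      dist_eq_norm_vsub V A C, zero_sub]
  rw [hCG, inner_sub_left, inner_neg_left, hBA, inner_smul_left, real_inner_self_eq_norm_sq,
    ← dist_eq_norm_vsub V B A, dist_comm B A]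
  simp [div_mul_cancel₀ _ (pow_pos hc 2).ne']

theorem semicircle_decomposition
    (A B C D E F G : EuclideanSpace ℝ (Fin 2))
    (hC : ∠ A C B = Real.pi / 2)
    (ha : 0 < dist B C) (hb : 0 < dist A C)
    (hD : D = midpoint ℝ A B) (hE : E = midpoint ℝ A C) (hF : F = midpoint ℝ B C)
    (hG : G = EuclideanGeometry.orthogonalProjection (affineSpan ℝ {A, B}) C)
    (Sc : Set (EuclideanSpace ℝ (Fin 2)))
    (hSc : Sc = {x | dist x D ≤ dist A B / 2 ∧ (affineSpan ℝ {A, B}).SSameSide x C})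
    (Sb : Set (EuclideanSpace ℝ (Fin 2)))
    (hSb : Sb = {x | dist x E ≤ dist A C / 2 ∧ (affineSpan ℝ {A, C}).SSameSide x B})
    (Sa : Set (EuclideanSpace ℝ (Fin 2)))
    (hSa : Sa = {x | dist x F ≤ dist B C / 2 ∧ (affineSpan ℝ {B, C}).SSameSide x A})
    (RA : Set (EuclideanSpace ℝ (Fin 2)))
    (hRA : RA = {x | dist x D ≤ dist A B / 2 ∧ (affineSpan ℝ {A, C}).SOppSide x B})
    (RB : Set (EuclideanSpace ℝ (Fin 2)))
    (hRB : RB = {x | dist x D ≤ dist A B / 2 ∧ (affineSpan ℝ {B, C}).SOppSide x A})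
    (RC : Set (EuclideanSpace ℝ (Fin 2)))
    (hRC : RC = {x | dist x E ≤ dist A C / 2 ∧ (affineSpan ℝ {A, B}).SOppSide x C})
    (RD : Set (EuclideanSpace ℝ (Fin 2)))
    (hRD : RD = {x | dist x E ≤ dist A C / 2 ∧ (affineSpan ℝ {C, G}).SOppSide x A})
    (RE : Set (EuclideanSpace ℝ (Fin 2)))
    (hRE : RE = {x | dist x F ≤ dist B C / 2 ∧ (affineSpan ℝ {C, G}).SOppSide x B})
    (RF : Set (EuclideanSpace ℝ (Fin 2)))
    (hRF : RF = {x | dist x F ≤ dist B C / 2 ∧ (affineSpan ℝ {A, B}).SOppSide x C}) :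
    (volume Sc).toReal
      = (volume Sa).toReal + (volume Sb).toReal
        + (volume RA).toReal + (volume RB).toReal
        - (volume RC).toReal - (volume RD).toReal
        - (volume RE).toReal - (volume RF).toReal := by
  have hsq : dist A B ^ 2 = dist A C ^ 2 + dist B C ^ 2 := by
    simpa only [sq] using (dist_sq_eq_dist_sq_add_dist_sq_iff_angle_eq_pi_div_two A C B).2 hC
  have hc : 0 < dist A B := by
    refine dist_nonneg.lt_of_ne fun h => ?_
    rw [← h] at hsq
    nlinarith
  have hncol : ¬ Collinear ℝ {A, C, B} := by
    rw [collinear_iff_eq_or_eq_or_angle_eq_zero_or_angle_eq_pi, hC]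
    have := Real.pi_pos
    rintro (h | h | h | h)
    · exact (dist_pos.1 hb) h
    · exact (dist_pos.1 ha) h
    · linarith
    · linarith
  have hB : B ∉ affineSpan ℝ {A, C} := fun h => hncol <|
    (collinear_insert_of_mem_affineSpan_pair h).subset (by grind)
  have hA : A ∉ affineSpan ℝ {B, C} := fun h => hncol <|
    (collinear_insert_of_mem_affineSpan_pair h).subset (by grind)
  have hGA : G = AffineMap.lineMap A B (dist A C ^ 2 / dist A B ^ 2) :=
    hG.trans (coe_orthogonalProjection_line_eq_lineMap_of_angle_eq_pi_div_two hC hc)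
  have hGB : G = AffineMap.lineMap B A (dist B C ^ 2 / dist B A ^ 2) := by
    have h : dist A C ^ 2 / dist A B ^ 2 = 1 - dist B C ^ 2 / dist A B ^ 2 := by
      field_simp
      linarith
    rw [hGA, h, AffineMap.lineMap_apply_one_sub, dist_comm B A]
  obtain ⟨hSb', hRC', hRD'⟩ := volume_halfDisk_and_segments_of_similarity hb hc hB hGA
  obtain ⟨hSa', hRF', hRE'⟩ :=
    volume_halfDisk_and_segments_of_similarity ha (dist_comm A B ▸ hc) hA hGB
  rw [Set.pair_comm B A, dist_comm B A, midpoint_comm B A] at hSa'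
  rw [Set.pair_comm B A, dist_comm B A, midpoint_comm B A] at hRF'
  rw [Set.pair_comm A C, dist_comm B A, midpoint_comm B A] at hRE'
  rw [Set.pair_comm C A] at hRE'
  rw [← hF] at hSa' hRF' hRE'
  rw [← hE] at hSb' hRC' hRD'
  rw [← hD] at hSa' hRF' hRE' hSb' hRC' hRD'
  rw [← hSa, ← hSc] at hSa'
  rw [← hSb, ← hSc] at hSb'
  rw [← hRC, ← hRA] at hRC'
  rw [← hRD, ← hRB] at hRD'
  rw [← hRF, ← hRB] at hRF'
  rw [← hRE, ← hRA] at hRE'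
  rw [hSa', hSb', hRC', hRD', hRE', hRF']
  simp only [ENNReal.toReal_mul, ENNReal.toReal_ofReal (sq_nonneg _)]
  have hone : (dist A C / dist A B) ^ 2 + (dist B C / dist A B) ^ 2 = 1 := by
    field_simp
    linarith
  linear_combination (-(volume Sc).toReal + (volume RA).toReal + (volume RB).toReal) * hone
end
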